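/- arXiv:2011.08486 — 8 statements merged into one kernel-verified Lean document; each statement's English description precedes it below -/
import Mathlib

section
/- Let p be a prime and m ≥ 1 with p^m ≡ 3 (mod 4). Let D = {x² : x ∈ F_{p^m} \ {0}} be the Paley difference set in the additive group of F_{p^m} and D^{(−1)} = {−x : x ∈ D}. Let α, β be two distinct nonzero elements of the prime subfield F_p of F_{p^m}. Then the set S = {(0,0)} ∪ {(x, αx) : x ∈ D} ∪ {(x, βx) : x ∈ D^{(−1)}} in the additive group G = F_{p^m} × F_{p^m} is a formally self dual set, i.e., there exists a group isomorphism Δ from G onto its dual group Ĝ such that S is formally self dual under Δ. -/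
open scoped Classical

/-- The (additive) weight enumerator `ν_S(g) = #{(s,t) ∈ S×S : s − t = g}`. -/
noncomputable def nuAdd {A : Type*} [AddGroup A] (S : Set A) (g : A) : ℕ :=
  Nat.card {p : A × A // p.1 ∈ S ∧ p.2 ∈ S ∧ p.1 - p.2 = g}

theorem ne_zero_of_not_isSquare {M : Type*} [MulZeroClass M] {x : M} (hx : ¬IsSquare x) :
    x ≠ 0 := by
  rintro rfl
  exact hx .zero

section SquaresInFiniteField

variable {F : Type*} [Field F] [Fintype F]

theorem ringChar_ne_two_of_card_mod_four (hF : Fintype.card F % 4 = 3) : ringChar F ≠ 2 := by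
  intro h
  have := FiniteField.even_card_iff_char_two.mp h
  omega

theorem quadraticChar_neg_of_card_mod_four (hF : Fintype.card F % 4 = 3) (x : F) :
    quadraticChar F (-x) = -quadraticChar F x := by
  have h : quadraticChar F (-1) = -1 := by
    rw [quadraticChar_neg_one_iff_not_isSquare, FiniteField.isSquare_neg_one_iff]
    simpa using hF
  rw [neg_eq_neg_one_mul, map_mul, h, neg_one_mul]

theorem isSquare_neg_iff_of_card_mod_four (hF : Fintype.card F % 4 = 3) {x : F} (hx : x ≠ 0) :
    IsSquare (-x) ↔ ¬IsSquare x := by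
  rw [← quadraticChar_one_iff_isSquare (neg_ne_zero.mpr hx),
    ← quadraticChar_neg_one_iff_not_isSquare, quadraticChar_neg_of_card_mod_four hF]
  omega

/-- Twice the indicator function of the squares, in terms of the quadratic character. -/
theorem two_mul_indicator_isSquare (x : F) :
    2 * (if IsSquare x then 1 else 0 : ℤ) = 1 + quadraticChar F x + if x = 0 then 1 else 0 := by
  by_cases h0 : x = 0
  · simp [h0]
  by_cases h : IsSquare x
  · simp [h, h0, (quadraticChar_one_iff_isSquare h0).mpr h]
  · simp [h, h0, quadraticChar_neg_one_iff_not_isSquare.mpr h]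

theorem two_mul_card_isSquare (hF : ringChar F ≠ 2) :
    2 * Finset.card {x : F | IsSquare x} = Fintype.card F + 1 := by
  have h : (2 * Finset.card {x : F | IsSquare x} : ℤ) = Fintype.card F + 1 := by
    rw [Finset.card_filter]
    push_cast
    rw [Finset.mul_sum, Finset.sum_congr rfl fun x _ ↦ two_mul_indicator_isSquare x]
    rw [Finset.sum_add_distrib, Finset.sum_add_distrib, quadraticChar_sum_zero hF]
    simp
  exact_mod_cast h

/-- The number of ways to write `u` as a difference of two squares, zero being a square. -/
noncomputable def squareDiffCount (u : F) : ℕ :=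
  Finset.card {p : F × F | IsSquare p.1 ∧ IsSquare p.2 ∧ p.1 - p.2 = u}

theorem squareDiffCount_neg (u : F) : squareDiffCount (-u) = squareDiffCount u := by
  refine Finset.card_equiv (Equiv.prodComm F F) fun p ↦ ?_
  have : p.1 - p.2 = -u ↔ p.2 - p.1 = u := by rw [← neg_inj, neg_neg, neg_sub]
  simp only [Finset.mem_filter_univ, Equiv.prodComm_apply, Prod.fst_swap, Prod.snd_swap, this]
  tauto

theorem squareDiffCount_of_isSquare {u : F} (hu : IsSquare u) (hu0 : u ≠ 0) :
    squareDiffCount u = squareDiffCount (1 : F) := by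
  symm
  refine Finset.card_equiv ((Equiv.mulLeft₀ u hu0).prodCongr (Equiv.mulLeft₀ u hu0)) fun p ↦ ?_
  have hsq (x : F) : IsSquare (u * x) ↔ IsSquare x :=
    ⟨fun h ↦ by simpa [hu0] using hu.inv.mul h, hu.mul⟩
  have : u * p.1 - u * p.2 = u ↔ p.1 - p.2 = 1 := by
    rw [← mul_sub, mul_eq_left₀ hu0]
  simp [hsq, this]

theorem four_mul_squareDiffCount (hF : Fintype.card F % 4 = 3) {u : F} (hu : u ≠ 0) :
    4 * squareDiffCount u = Fintype.card F + 1 := by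
  have hconst (v : F) (hv : v ≠ 0) : squareDiffCount v = squareDiffCount (1 : F) := by
    by_cases h : IsSquare v
    · exact squareDiffCount_of_isSquare h hv
    · rw [← squareDiffCount_neg]
      exact squareDiffCount_of_isSquare ((isSquare_neg_iff_of_card_mod_four hF hv).mpr h)
        (neg_ne_zero.mpr hv)
  set N := Finset.card {x : F | IsSquare x} with hN
  have hcard : 2 * N = Fintype.card F + 1 :=
    two_mul_card_isSquare (ringChar_ne_two_of_card_mod_four hF)
  have hzero : squareDiffCount (0 : F) = N := by
    refine Finset.card_nbij' Prod.fst (fun x ↦ (x, x)) ?_ ?_ ?_ ?_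
    · intro p; simp +contextual
    · intro p; simp +contextual
    · rintro ⟨x, y⟩; simp +contextual [sub_eq_zero]
    · intro p; simp
  have htotal : ∑ v : F, squareDiffCount v = N * N := by
    rw [hN, ← Finset.card_product, Finset.card_eq_sum_card_fiberwise
      (f := fun p : F × F ↦ p.1 - p.2) (t := Finset.univ) (fun _ _ ↦ by simp)]
    refine Finset.sum_congr rfl fun v _ ↦ congrArg Finset.card ?_
    ext p
    simp [and_assoc]
  rw [← Finset.add_sum_erase _ _ (Finset.mem_univ 0), hzero,
    Finset.sum_congr rfl fun v hv ↦ hconst v (Finset.ne_of_mem_erase hv), Finset.sum_const,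
    Finset.card_erase_of_mem (Finset.mem_univ _), Finset.card_univ, smul_eq_mul] at htotal
  rw [hconst u hu]
  obtain ⟨k, hk⟩ : ∃ k, N = k + 2 := ⟨N - 2, by omega⟩
  have hq : Fintype.card F - 1 = 2 * (k + 1) := by omega
  rw [hq, hk] at htotal
  have : 2 * squareDiffCount (1 : F) = k + 2 :=
    Nat.eq_of_mul_eq_mul_right k.succ_pos (by rw [Nat.succ_eq_add_one]; linarith)
  omega

/-- The map sending a square `x` to `(x, 0)` and a nonsquare `x` to `(0, x)`. -/
noncomputable def squareSplit (x : F) : F × F :=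
  if IsSquare x then (x, 0) else (0, x)

theorem squareSplit_of_isSquare {x : F} (hx : IsSquare x) : squareSplit x = (x, 0) := if_pos hx

theorem squareSplit_of_not_isSquare {x : F} (hx : ¬IsSquare x) : squareSplit x = (0, x) :=
  if_neg hx

theorem squareSplit_fst_add_snd (x : F) : (squareSplit x).1 + (squareSplit x).2 = x := by
  by_cases hx : IsSquare x <;> simp [squareSplit, hx]

theorem squareSplit_injective : Function.Injective (squareSplit (F := F)) := fun x y h ↦ by
  rw [← squareSplit_fst_add_snd x, h, squareSplit_fst_add_snd]

theorem card_squareSplit_sub_eq_zero :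
    Finset.card {p : F × F | squareSplit p.1 - squareSplit p.2 = 0} = Fintype.card F := by
  rw [← Finset.card_univ]
  refine Finset.card_nbij' Prod.fst (fun x ↦ (x, x)) ?_ ?_ ?_ ?_
  · intro p; simp
  · intro p; simp
  · rintro ⟨x, y⟩; simp +contextual [sub_eq_zero, squareSplit_injective.eq_iff]
  · intro p; simp

theorem card_squareSplit_sub_eq_fst {u : F} (hu : u ≠ 0) :
    Finset.card {p : F × F | squareSplit p.1 - squareSplit p.2 = (u, 0)} =
      squareDiffCount u := by
  refine congrArg Finset.card (Finset.filter_congr ?_)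
  rintro ⟨x, y⟩ -
  by_cases hx : IsSquare x <;> by_cases hy : IsSquare y
  · simp [squareSplit, hx, hy]
  · simp [squareSplit, hx, hy, ne_zero_of_not_isSquare hy]
  · simp [squareSplit, hx, hy, ne_zero_of_not_isSquare hx]
  · simp [squareSplit, hx, hy, hu.symm]

theorem card_squareSplit_sub_eq_snd (hF : Fintype.card F % 4 = 3) {v : F} (hv : v ≠ 0) :
    Finset.card {p : F × F | squareSplit p.1 - squareSplit p.2 = (0, v)} =
      squareDiffCount v := by
  rw [← squareDiffCount_neg]
  refine Finset.card_equiv ((Equiv.neg F).prodCongr (Equiv.neg F)) ?_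
  rintro ⟨x, y⟩
  have hneg : -x - -y = -v ↔ x - y = v := by rw [← neg_inj, neg_neg, neg_sub', neg_neg, neg_neg]
  simp only [Finset.mem_filter_univ, Equiv.prodCongr_apply, Prod.map_apply, Equiv.neg_apply, hneg]
  have h0 : squareSplit (0 : F) = 0 := squareSplit_of_isSquare .zero
  have key {z : F} (hz : z ≠ 0) : IsSquare (-z) ↔ ¬IsSquare z :=
    isSquare_neg_iff_of_card_mod_four hF hz
  rcases eq_or_ne x 0 with rfl | hx0 <;> rcases eq_or_ne y 0 with rfl | hy0
  · simp [h0, Prod.ext_iff]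
  · by_cases hy : IsSquare y <;> simp [squareSplit, hy, hy0, key, hv.symm]
  · by_cases hx : IsSquare x <;> simp [squareSplit, hx, hx0, key, hv.symm]
  · by_cases hx : IsSquare x <;> by_cases hy : IsSquare y <;>
      simp [squareSplit, hx, hy, hx0, hy0, key, hv.symm]

theorem card_squareSplit_sub_eq_of_ne_zero (hF : Fintype.card F % 4 = 3) {u v : F} (hu : u ≠ 0)
    (hv : v ≠ 0) :
    Finset.card {p : F × F | squareSplit p.1 - squareSplit p.2 = (u, v)} =
      if IsSquare u ↔ IsSquare v then 1 else 0 := by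
  have hu' := isSquare_neg_iff_of_card_mod_four hF hu
  have hv' := isSquare_neg_iff_of_card_mod_four hF hv
  have key (x y : F) : squareSplit x - squareSplit y = (u, v) ↔
      (IsSquare u ∧ IsSquare v ∧ x = u ∧ y = -v) ∨
        (¬IsSquare u ∧ ¬IsSquare v ∧ x = v ∧ y = -u) := by
    constructor
    · by_cases hx : IsSquare x <;> by_cases hy : IsSquare y
      · simp [squareSplit, hx, hy, hv.symm]
      · simp only [squareSplit, hx, hy, if_true, if_false, Prod.mk_sub_mk, Prod.mk.injEq, sub_zero,
          zero_sub]
        rintro ⟨rfl, rfl⟩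
        simp_all
      · simp only [squareSplit, hx, hy, if_true, if_false, Prod.mk_sub_mk, Prod.mk.injEq, sub_zero,
          zero_sub]
        rintro ⟨rfl, rfl⟩
        simp_all
      · simp [squareSplit, hx, hy, hu.symm]
    · rintro (⟨h1, h2, rfl, rfl⟩ | ⟨h1, h2, rfl, rfl⟩)
      · simp [squareSplit, h1, h2, hv']
      · simp [squareSplit, h1, h2, hu']
  simp only [key]
  by_cases h1 : IsSquare u <;> by_cases h2 : IsSquare v <;> simp [h1, h2]
  · exact Finset.card_eq_one.mpr ⟨(u, -v), by ext ⟨x, y⟩; simp⟩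
  · exact Finset.card_eq_one.mpr ⟨(v, -u), by ext ⟨x, y⟩; simp⟩

theorem four_mul_card_squareSplit_sub_eq (hF : Fintype.card F % 4 = 3) (u v : F) :
    4 * (Finset.card {p : F × F | squareSplit p.1 - squareSplit p.2 = (u, v)} : ℤ) =
      Fintype.card F * ((if u = 0 then 1 else 0) + (if v = 0 then 1 else 0)) ^ 2 +
        (quadraticChar F u + quadraticChar F v) ^ 2 := by
  rcases eq_or_ne u 0 with rfl | hu <;> rcases eq_or_ne v 0 with rfl | hv
  · have := card_squareSplit_sub_eq_zero (F := F)
    rw [← Prod.mk_zero_zero] at this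
    rw [this]
    simp
    ring
  · rw [card_squareSplit_sub_eq_snd hF hv]
    have := four_mul_squareDiffCount hF hv
    rw [quadraticChar_zero, zero_add, quadraticChar_sq_one hv]
    simpa [hv] using mod_cast this
  · rw [card_squareSplit_sub_eq_fst hu]
    have := four_mul_squareDiffCount hF hu
    rw [quadraticChar_zero, add_zero, quadraticChar_sq_one hu]
    simpa [hu] using mod_cast this
  · rw [card_squareSplit_sub_eq_of_ne_zero hF hu hv]
    have key {z : F} (hz : z ≠ 0) : quadraticChar F z = if IsSquare z then 1 else -1 := by
      split_ifs with h
      · exact (quadraticChar_one_iff_isSquare hz).mpr h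
      · exact quadraticChar_neg_one_iff_not_isSquare.mpr h
    rw [key hu, key hv]
    by_cases h1 : IsSquare u <;> by_cases h2 : IsSquare v <;> simp [h1, h2, hu, hv]

/-- The quadratic character of `F` with complex values. -/
noncomputable def complexQuadraticChar (F : Type*) [Field F] [Fintype F] : MulChar F ℂ :=
  (quadraticChar F).ringHomComp (Int.castRingHom ℂ)

theorem complexQuadraticChar_apply (x : F) :
    complexQuadraticChar F x = (quadraticChar F x : ℂ) := rfl

theorem sum_addChar_mul {ψ : AddChar F ℂ} (hψ : ψ.IsPrimitive) (a : F) :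
    ∑ x : F, ψ (a * x) = if a = 0 then (Fintype.card F : ℂ) else 0 := by
  simpa [mul_comm] using AddChar.sum_mulShift a hψ

theorem sum_quadraticChar_mul_addChar_mul (hF : ringChar F ≠ 2) (ψ : AddChar F ℂ) (a : F) :
    ∑ x : F, complexQuadraticChar F x * ψ (a * x) =
      complexQuadraticChar F a * gaussSum (complexQuadraticChar F) ψ := by
  rcases eq_or_ne a 0 with rfl | ha
  · simpa [complexQuadraticChar_apply] using
      congrArg (Int.cast : ℤ → ℂ) (quadraticChar_sum_zero hF)
  · have h := gaussSum_mulShift (complexQuadraticChar F) ψ (Units.mk0 a ha)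
    have hsq : complexQuadraticChar F a * complexQuadraticChar F a = 1 := by
      rw [complexQuadraticChar_apply, ← sq]
      exact_mod_cast quadraticChar_sq_one ha
    rw [← h, Units.val_mk0, ← mul_assoc, hsq, one_mul]
    rfl

theorem gaussSum_complexQuadraticChar_sq (hF : Fintype.card F % 4 = 3) {ψ : AddChar F ℂ}
    (hψ : ψ.IsPrimitive) :
    gaussSum (complexQuadraticChar F) ψ ^ 2 = -(Fintype.card F : ℂ) := by
  rw [complexQuadraticChar,
    gaussSum_sq ((MulChar.ringHomComp_ne_one_iff (RingHom.injective_int _)).mpr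
      (quadraticChar_ne_one (ringChar_ne_two_of_card_mod_four hF)))
      ((quadraticChar_isQuadratic F).comp _) hψ,
    MulChar.ringHomComp_apply, quadraticChar_neg_of_card_mod_four hF]
  simp

theorem two_mul_sum_addChar_squareSplit (hF : Fintype.card F % 4 = 3) {ψ : AddChar F ℂ}
    (hψ : ψ.IsPrimitive) (a b : F) :
    2 * ∑ x : F, ψ (a * (squareSplit x).1 - b * (squareSplit x).2) =
      Fintype.card F * ((if a = 0 then 1 else 0) + (if b = 0 then 1 else 0)) +
        (complexQuadraticChar F a + complexQuadraticChar F b) *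
          gaussSum (complexQuadraticChar F) ψ := by
  have hpoint (x : F) : 2 * ψ (a * (squareSplit x).1 - b * (squareSplit x).2) =
      ψ (a * x) + ψ (-b * x) + complexQuadraticChar F x * ψ (a * x) -
        complexQuadraticChar F x * ψ (-b * x) := by
    rw [complexQuadraticChar_apply]
    rcases eq_or_ne x 0 with rfl | h0
    · simp [squareSplit]
      norm_num
    by_cases h : IsSquare x
    · simp [squareSplit, h, (quadraticChar_one_iff_isSquare h0).mpr h]
      ring
    · simp [squareSplit, h, quadraticChar_neg_one_iff_not_isSquare.mpr h]
      ring
  have hF2 := ringChar_ne_two_of_card_mod_four hF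
  have hneg : complexQuadraticChar F (-b) = -complexQuadraticChar F b := by
    simp [complexQuadraticChar_apply, quadraticChar_neg_of_card_mod_four hF]
  rw [Finset.mul_sum, Finset.sum_congr rfl fun x _ ↦ hpoint x, Finset.sum_sub_distrib,
    Finset.sum_add_distrib, Finset.sum_add_distrib, sum_addChar_mul hψ, sum_addChar_mul hψ,
    sum_quadraticChar_mul_addChar_mul hF2, sum_quadraticChar_mul_addChar_mul hF2, hneg]
  simp only [neg_eq_zero]
  split_ifs <;> ring

theorem Complex.norm_add_mul_sq_of_sq_eq_neg {z : ℂ} {c : ℝ} (hc : 0 < c) (hz : z ^ 2 = -(c : ℂ))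
    (r s : ℝ) : ‖(r : ℂ) + s * z‖ ^ 2 = r ^ 2 + c * s ^ 2 := by
  have hre := congrArg Complex.re hz
  have him := congrArg Complex.im hz
  simp only [sq, Complex.mul_re, Complex.mul_im, Complex.neg_re, Complex.neg_im, Complex.ofReal_re,
    Complex.ofReal_im] at hre him
  have hz0 : z.re = 0 := by
    by_contra h
    have : z.im = 0 := by
      have : z.re * z.im = 0 := by linarith
      simpa [h] using this
    rw [this] at hre
    nlinarith [mul_self_nonneg z.re]
  rw [← Complex.normSq_eq_norm_sq, Complex.normSq_apply]
  simp only [Complex.add_re, Complex.add_im, Complex.mul_re, Complex.mul_im, Complex.ofReal_re,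
    Complex.ofReal_im, hz0]
  rw [hz0] at hre
  linear_combination (-s ^ 2) * hre

/-- The set `{squareSplit x | x}` is formally self dual under the pairing
`(a, b), (u, v) ↦ ψ (a * u - b * v)`. -/
theorem norm_sq_sum_addChar_squareSplit (hF : Fintype.card F % 4 = 3) {ψ : AddChar F ℂ}
    (hψ : ψ.IsPrimitive) (g : F × F) :
    ‖∑ x : F, ψ (g.1 * (squareSplit x).1 - g.2 * (squareSplit x).2)‖ ^ 2 =
      (Fintype.card F : ℝ) *
        Finset.card {p : F × F | squareSplit p.1 - squareSplit p.2 = g} := by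
  obtain ⟨a, b⟩ := g
  have hcount := congrArg (Int.cast : ℤ → ℝ) (four_mul_card_squareSplit_sub_eq hF a b)
  push_cast at hcount
  have hsum := congrArg (fun z : ℂ ↦ ‖z‖ ^ 2) (two_mul_sum_addChar_squareSplit hF hψ a b)
  have hnorm := Complex.norm_add_mul_sq_of_sq_eq_neg (c := Fintype.card F)
    (by exact_mod_cast Fintype.card_pos) (by simpa using gaussSum_complexQuadraticChar_sq hF hψ)
    (Fintype.card F * ((if a = 0 then 1 else 0) + (if b = 0 then 1 else 0)))
    (quadraticChar F a + quadraticChar F b)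
  simp only [Complex.ofReal_add, Complex.ofReal_mul, Complex.ofReal_natCast, Complex.ofReal_intCast,
    apply_ite Complex.ofReal, Complex.ofReal_one, Complex.ofReal_zero] at hnorm
  simp only [complexQuadraticChar_apply, norm_mul, mul_pow] at hsum
  rw [hnorm, Complex.norm_ofNat] at hsum
  linear_combination hsum / 4 - (Fintype.card F : ℝ) / 4 * hcount

theorem exists_mulEquiv_addChar_prod {ψ : AddChar F ℂ} (hψ : ψ.IsPrimitive)
    (e : F × F ≃+ F × F) :
    ∃ Δ : Multiplicative (F × F) ≃* AddChar (F × F) ℂˣ, ∀ g s : F × F,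
      ((Δ (Multiplicative.ofAdd g) s : ℂˣ) : ℂ) =
        ψ ((e g).1 * (e s).1 - (e g).2 * (e s).2) := by
  let χ : AddChar F ℂˣ := AddChar.toMonoidHomEquiv.symm ψ.toMonoidHom.toHomUnits
  have hχ (x : F) : (χ x : ℂ) = ψ x := rfl
  let pairing (g : F × F) : F × F →+ F :=
    ((AddMonoidHom.mulLeft (e g).1).comp (AddMonoidHom.fst F F) -
      (AddMonoidHom.mulLeft (e g).2).comp (AddMonoidHom.snd F F)).comp e.toAddMonoidHom
  have hpairing (g s : F × F) : pairing g s = (e g).1 * (e s).1 - (e g).2 * (e s).2 := rfl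
  let Δ : Multiplicative (F × F) →* AddChar (F × F) ℂˣ :=
    MonoidHom.mk' (fun g ↦ χ.compAddMonoidHom (pairing g.toAdd)) fun g h ↦ by
      ext s
      simp only [AddChar.compAddMonoidHom_apply, AddChar.mul_apply, ← AddChar.map_add_eq_mul,
        hpairing, toAdd_mul, map_add, Prod.fst_add, Prod.snd_add]
      congr 2
      ring
  have hΔ (g : Multiplicative (F × F)) (s : F × F) :
      (Δ g s : ℂ) = ψ ((e g.toAdd).1 * (e s).1 - (e g.toAdd).2 * (e s).2) := rfl
  have hinj : Function.Injective Δ := by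
    rw [injective_iff_map_eq_one]
    intro g hg
    have hone (s : F × F) : ψ ((e g.toAdd).1 * s.1 - (e g.toAdd).2 * s.2) = 1 := by
      have := hΔ g (e.symm s)
      rw [hg] at this
      simpa using this.symm
    have h1 : (e g.toAdd).1 = 0 := by
      by_contra h
      refine hψ h (AddChar.ext _ _ fun x ↦ ?_)
      simpa [AddChar.mulShift_apply] using hone (x, 0)
    have h2 : (e g.toAdd).2 = 0 := by
      by_contra h
      refine hψ h (AddChar.ext _ _ fun x ↦ ?_)
      simpa [AddChar.mulShift_apply] using hone (0, -x)
    have : e g.toAdd = 0 := Prod.ext h1 h2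
    exact toAdd_eq_zero.mp (by simpa using this)
  have hcoe : Function.Injective fun φ : AddChar (F × F) ℂˣ ↦ (Units.coeHom ℂ).compAddChar φ :=
    MonoidHom.compAddChar_injective_right _ Units.val_injective
  have := Finite.of_injective _ hcoe
  have hcard : Nat.card (AddChar (F × F) ℂˣ) ≤ Nat.card (Multiplicative (F × F)) := by
    refine (Nat.card_le_card_of_injective _ hcoe).trans_eq ?_
    rw [Nat.card_eq_fintype_card, AddChar.card_eq, Nat.card_eq_fintype_card,
      Fintype.card_multiplicative]
  exact ⟨MulEquiv.ofBijective Δ (hinj.bijective_of_nat_card_le hcard), fun g s ↦ hΔ _ s⟩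

end SquaresInFiniteField

theorem nuAdd_range {ι A : Type*} [Fintype ι] [AddGroup A] [DecidableEq A] {f : ι → A}
    (hf : Function.Injective f) (g : A) :
    nuAdd (Set.range f) g = Finset.card {p : ι × ι | f p.1 - f p.2 = g} := by
  rw [nuAdd, ← Fintype.card_subtype, ← Nat.card_eq_fintype_card]
  refine (Nat.card_congr (Equiv.ofBijective
    (fun p : {p : ι × ι // f p.1 - f p.2 = g} ↦
      (⟨(f p.1.1, f p.1.2), ⟨_, rfl⟩, ⟨_, rfl⟩, p.2⟩ :
        {p : A × A // p.1 ∈ Set.range f ∧ p.2 ∈ Set.range f ∧ p.1 - p.2 = g})) ⟨?_, ?_⟩)).symm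
  · rintro ⟨⟨x, y⟩, h⟩ ⟨⟨x', y'⟩, h'⟩ heq
    simpa [hf.eq_iff] using heq
  · rintro ⟨⟨a, b⟩, ⟨x, hx⟩, ⟨y, hy⟩, h⟩
    obtain rfl : f x = a := hx
    obtain rfl : f y = b := hy
    exact ⟨⟨(x, y), h⟩, rfl⟩

/-- The coordinates of a vector of `F × F` in the basis `(1, α)`, `(1, β)`. -/
noncomputable def slopeCoordinates {F : Type*} [Field F] {α β : F} (hαβ : α ≠ β) :
    F × F ≃+ F × F where
  toFun g := ((g.2 - β * g.1) / (α - β), (α * g.1 - g.2) / (α - β))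
  invFun w := (w.1 + w.2, α * w.1 + β * w.2)
  left_inv g := by
    have := sub_ne_zero.mpr hαβ
    ext <;> field_simp <;> ring
  right_inv w := by
    have := sub_ne_zero.mpr hαβ
    ext <;> field_simp <;> ring
  map_add' g h := by
    ext <;> simp only [Prod.fst_add, Prod.snd_add] <;> ring

theorem slopeCoordinates_symm_apply {F : Type*} [Field F] {α β : F} (hαβ : α ≠ β) (w : F × F) :
    (slopeCoordinates hαβ).symm w = (w.1 + w.2, α * w.1 + β * w.2) := rfl

/-- The set built from the Paley difference set is formally self dual:
there exists an isomorphism `Δ` from `G = F × F` onto its dual group (the group of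
characters `G → ℂ*`) with `|∑_{s∈S} [Δg](s)|² = |S|·ν_S(g)` for all `g ∈ G`. -/
theorem stmt0 (p m : ℕ) [Fact p.Prime] (hm : 1 ≤ m) (hmod : p ^ m % 4 = 3)
    (F : Type*) [Field F] [Fintype F] (hcard : Fintype.card F = p ^ m)
    (α β : F) (hα : α ∈ (⊥ : Subfield F)) (hβ : β ∈ (⊥ : Subfield F))
    (hα0 : α ≠ 0) (hβ0 : β ≠ 0) (hαβ : α ≠ β) :
    let D : Set F := {y | ∃ x : F, x ≠ 0 ∧ y = x ^ 2}
    let Dinv : Set F := {y | ∃ x ∈ D, y = -x}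
    let S : Set (F × F) :=
      {((0 : F), (0 : F))} ∪ {q | ∃ x ∈ D, q = (x, α * x)} ∪ {q | ∃ x ∈ Dinv, q = (x, β * x)}
    ∃ Δ : Multiplicative (F × F) ≃* AddChar (F × F) ℂˣ,
      ∀ g : F × F,
        ‖∑ᶠ s ∈ S, (((Δ (Multiplicative.ofAdd g)) s : ℂˣ) : ℂ)‖ ^ 2
          = (Nat.card S : ℝ) * nuAdd S g := by
  intro D Dinv S
  have hF : Fintype.card F % 4 = 3 := hcard ▸ hmod
  let e := slopeCoordinates hαβ
  let f : F → F × F := fun x ↦ e.symm (squareSplit x)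
  have hf : Function.Injective f := e.symm.injective.comp squareSplit_injective
  have hsq {x : F} (hx : IsSquare x) : f x = (x, α * x) := by
    simp [f, e, slopeCoordinates_symm_apply, squareSplit_of_isSquare hx]
  have hnsq {x : F} (hx : ¬IsSquare x) : f x = (x, β * x) := by
    simp [f, e, slopeCoordinates_symm_apply, squareSplit_of_not_isSquare hx]
  have hD (x : F) : x ∈ D ↔ x ≠ 0 ∧ IsSquare x := by
    constructor
    · rintro ⟨y, hy, rfl⟩
      exact ⟨pow_ne_zero 2 hy, .sq y⟩
    · rintro ⟨hx, y, rfl⟩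
      exact ⟨y, left_ne_zero_of_mul hx, (sq y).symm⟩
  have hDinv (x : F) : x ∈ Dinv ↔ ¬IsSquare x := by
    constructor
    · rintro ⟨y, hy, rfl⟩
      obtain ⟨hy0, hy⟩ := (hD y).mp hy
      rwa [isSquare_neg_iff_of_card_mod_four hF hy0, not_not]
    · intro hx
      have hx0 := ne_zero_of_not_isSquare hx
      exact ⟨-x, (hD _).mpr ⟨neg_ne_zero.mpr hx0,
        (isSquare_neg_iff_of_card_mod_four hF hx0).mpr hx⟩, (neg_neg x).symm⟩
  have hS : S = Set.range f := by
    ext g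
    constructor
    · rintro ((rfl | ⟨x, hx, rfl⟩) | ⟨x, hx, rfl⟩)
      · exact ⟨0, by rw [hsq .zero, mul_zero]⟩
      · exact ⟨x, hsq ((hD x).mp hx).2⟩
      · exact ⟨x, hnsq ((hDinv x).mp hx)⟩
    · rintro ⟨x, rfl⟩
      rcases eq_or_ne x 0 with rfl | hx0
      · exact .inl (.inl (by rw [hsq .zero, mul_zero]; rfl))
      by_cases hx : IsSquare x
      · exact .inl (.inr ⟨x, (hD x).mpr ⟨hx0, hx⟩, hsq hx⟩)
      · exact .inr ⟨x, (hDinv x).mpr hx, hnsq hx⟩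
  have hψ := AddChar.FiniteField.primitiveChar_to_Complex_isPrimitive F
  obtain ⟨Δ, hΔ⟩ := exists_mulEquiv_addChar_prod hψ e
  refine ⟨Δ, fun g ↦ ?_⟩
  have hcount : nuAdd S g =
      Finset.card {p : F × F | squareSplit p.1 - squareSplit p.2 = e g} := by
    rw [hS, nuAdd_range hf]
    refine congrArg Finset.card (Finset.filter_congr fun p _ ↦ ?_)
    rw [← map_sub, AddEquiv.symm_apply_eq]
  rw [hcount, hS, finsum_mem_range hf, finsum_eq_sum_of_fintype,
    Nat.card_congr (Equiv.ofInjective f hf).symm, Nat.card_eq_fintype_card,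
    ← norm_sq_sum_addChar_squareSplit hF hψ (e g)]
  simp only [hΔ, f, AddEquiv.apply_symm_apply]
end

section
/- Let G be a finite abelian group, Δ : G → Ĝ an isomorphism with adjoint Δ_*, and S, T nonempty subsets of G. Then S and T form a formally dual pair under Δ if and only if T and S form a formally dual pair under Δ_*. In particular, S is formally self dual under Δ if and only if S is formally self dual under Δ_*. -/
variable {G : Type*} [CommGroup G] [Fintype G]

/-- The weight enumerator `ν_T(χ) = #{(φ,ψ) ∈ T×T : φ·ψ⁻¹ = χ}`. -/
noncomputable def nu {A : Type*} [Group A] (T : Finset A) (g : A) : ℕ :=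
  Nat.card {p : A × A // p.1 ∈ T ∧ p.2 ∈ T ∧ p.1 * p.2⁻¹ = g}

/-- `S ⊆ G` and `T ⊆ Ĝ` form a formally dual pair:
`|∑_{s∈S} χ(s)|² = (|S|²/|T|)·ν_T(χ)` for every character `χ`. -/
def FormallyDualPair (S : Finset G) (T : Finset (G →* ℂˣ)) : Prop :=
  ∀ χ : G →* ℂˣ, ‖∑ s ∈ S, (χ s : ℂ)‖ ^ 2 = (S.card : ℝ) ^ 2 / (T.card : ℝ) * nu T χ

/-- `S` and `T` form a formally dual pair under an isomorphism `Δ : G ≃ Ĝ`. -/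
def FormallyDualPairUnder (Δ : G ≃* (G →* ℂˣ)) (S T : Finset G) : Prop :=
  FormallyDualPair S (T.map Δ.toEquiv.toEmbedding)

open Classical in
theorem nu_eq_sum {A : Type*} [Group A] (T : Finset A) (g : A) :
    nu T g = ∑ s ∈ T, ∑ t ∈ T, if s * t⁻¹ = g then 1 else 0 := by
  rw [← Finset.sum_product', ← Finset.card_filter, nu, Nat.subtype_card]
  simp [and_assoc]

theorem nu_map {A B : Type*} [Group A] [Group B] (e : A ≃* B) (T : Finset A) (g : A) :
    nu (T.map e.toEquiv.toEmbedding) (e g) = nu T g := by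
  classical
  simp only [nu_eq_sum, Finset.sum_map, Equiv.coe_toEmbedding, MulEquiv.toEquiv_eq_coe,
    MulEquiv.coe_toEquiv, ← map_inv, ← map_mul, e.injective.eq_iff]

theorem nu_one {A : Type*} [Group A] (T : Finset A) : nu T 1 = T.card := by
  classical
  simp [nu_eq_sum, mul_inv_eq_one]

theorem sum_nu_mul {A : Type*} [Group A] [Fintype A] (T : Finset A) (f : A → ℂ) :
    ∑ g, (nu T g : ℂ) * f g = ∑ s ∈ T, ∑ t ∈ T, f (s * t⁻¹) := by
  classical
  simp only [nu_eq_sum, Nat.cast_sum, Finset.sum_mul]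
  rw [Finset.sum_comm]
  refine Finset.sum_congr rfl fun s _ => ?_
  rw [Finset.sum_comm]
  refine Finset.sum_congr rfl fun t _ => ?_
  simp

theorem conj_character (χ : G →* ℂˣ) (g : G) :
    (starRingEnd ℂ) (χ g : ℂ) = (χ g⁻¹ : ℂ) := by
  have h : ‖(χ g : ℂ)‖ = 1 := by
    refine Complex.norm_eq_one_of_pow_eq_one (n := Fintype.card G) ?_ Fintype.card_ne_zero
    rw [← Units.val_pow_eq_pow_val, ← map_pow, pow_card_eq_one, map_one, Units.val_one]
  rw [map_inv, Units.val_inv_eq_inv_val, Complex.inv_eq_conj h]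

theorem norm_sq_sum_character (χ : G →* ℂˣ) (S : Finset G) :
    ((‖∑ s ∈ S, (χ s : ℂ)‖ ^ 2 : ℝ) : ℂ) = ∑ s ∈ S, ∑ t ∈ S, (χ (s * t⁻¹) : ℂ) := by
  rw [Complex.ofReal_pow, ← Complex.mul_conj', map_sum, Finset.sum_mul_sum]
  simp only [conj_character, map_mul, Units.val_mul]

open Classical in
theorem sum_character (χ : G →* ℂˣ) :
    ∑ g, (χ g : ℂ) = if χ = 1 then (Fintype.card G : ℂ) else 0 := by
  have h := sum_hom_units ((Units.coeHom ℂ).comp χ)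
  have h1 : (Units.coeHom ℂ).comp χ = 1 ↔ χ = 1 := by
    simp [MonoidHom.ext_iff]
  simpa [h1] using h

theorem formallyDualPairUnder_iff {H : Type*} [CommGroup H] (Δ : H ≃* (H →* ℂˣ))
    (S T : Finset H) :
    FormallyDualPairUnder Δ S T ↔
      ∀ y, ‖∑ s ∈ S, (Δ y s : ℂ)‖ ^ 2 = (S.card : ℝ) ^ 2 / T.card * nu T y := by
  rw [FormallyDualPairUnder, FormallyDualPair, Δ.surjective.forall]
  simp only [nu_map, Finset.card_map]

/-- Fourier inversion for the weight enumerator of `S`. -/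
theorem sum_norm_sq_mul_character (Δ Δstar : G ≃* (G →* ℂˣ))
    (hadj : ∀ x y : G, (Δstar y) x = (Δ x) y) (S : Finset G) (x : G) :
    ∑ y, ((‖∑ s ∈ S, (Δ y s : ℂ)‖ ^ 2 : ℝ) : ℂ) * (Δ y x⁻¹ : ℂ) =
      Fintype.card G * nu S x := by
  classical
  simp only [norm_sq_sum_character, Finset.sum_mul, ← Units.val_mul, ← map_mul]
  simp only [← hadj]
  rw [Finset.sum_comm, nu_eq_sum, Nat.cast_sum, Finset.mul_sum]
  refine Finset.sum_congr rfl fun s _ => ?_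
  rw [Finset.sum_comm, Nat.cast_sum, Finset.mul_sum]
  refine Finset.sum_congr rfl fun t _ => ?_
  rw [sum_character]
  simp only [EmbeddingLike.map_eq_one_iff, mul_inv_eq_one]
  simp

theorem FormallyDualPairUnder.adjoint {Δ Δstar : G ≃* (G →* ℂˣ)}
    (hadj : ∀ x y : G, (Δstar y) x = (Δ x) y) {S T : Finset G} (hS : S.Nonempty)
    (hT : T.Nonempty) (h : FormallyDualPairUnder Δ S T) :
    FormallyDualPairUnder Δstar T S := by
  rw [formallyDualPairUnder_iff] at h ⊢
  have hS0 : (S.card : ℝ) ≠ 0 := by exact_mod_cast hS.card_pos.ne'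
  have hT0 : (T.card : ℝ) ≠ 0 := by exact_mod_cast hT.card_pos.ne'
  have key (x : G) : (Fintype.card G : ℝ) * nu S x =
      (S.card : ℝ) ^ 2 / T.card * ‖∑ t ∈ T, (Δstar x t : ℂ)‖ ^ 2 := by
    have h1 := sum_norm_sq_mul_character Δ Δstar hadj S x
    simp only [h, Complex.ofReal_mul, mul_assoc, ← Finset.mul_sum, Complex.ofReal_natCast] at h1
    rw [sum_nu_mul T fun y => (Δ y x⁻¹ : ℂ)] at h1
    have h2 : ∑ s ∈ T, ∑ t ∈ T, (Δ (s * t⁻¹) x⁻¹ : ℂ) =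
        ((‖∑ t ∈ T, (Δstar x t : ℂ)‖ ^ 2 : ℝ) : ℂ) := by
      rw [norm_sq_sum_character, Finset.sum_comm]
      refine Finset.sum_congr rfl fun s _ => Finset.sum_congr rfl fun t _ => ?_
      rw [← hadj, map_inv, MonoidHom.inv_apply, ← map_inv, mul_inv_rev, inv_inv]
    rw [h2] at h1
    exact_mod_cast h1.symm
  have hcard : (Fintype.card G : ℝ) = S.card * T.card := by
    have h1 := key 1
    simp only [nu_one, map_one, MonoidHom.one_apply, Units.val_one, Finset.sum_const,
      nsmul_eq_mul, mul_one, Complex.norm_natCast] at h1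
    field_simp at h1
    linarith
  intro x
  have h1 := key x
  rw [hcard] at h1
  field_simp at h1 ⊢
  linarith

theorem stmt3 (Δ Δstar : G ≃* (G →* ℂˣ))
    (hadj : ∀ x y : G, (Δstar y) x = (Δ x) y)
    (S T : Finset G) (hS : S.Nonempty) (hT : T.Nonempty) :
    (FormallyDualPairUnder Δ S T ↔ FormallyDualPairUnder Δstar T S) ∧
    (FormallyDualPairUnder Δ S S ↔ FormallyDualPairUnder Δstar S S) := by
  have hadj' : ∀ x y : G, (Δ y) x = (Δstar x) y := fun x y => (hadj y x).symm
  exact ⟨⟨.adjoint hadj hS hT, .adjoint hadj' hT hS⟩,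
    ⟨.adjoint hadj hS hS, .adjoint hadj' hS hS⟩⟩
end

section
/- Let q = p^k with p prime, n ≥ 1, and let C be a nonempty subset of F_q^n. Then for all complex numbers X, Y: D_C(X + (q−1)Y, X − Y) = (1/|C|)·∑_{x ∈ F_q^n} |∑_{c ∈ C} χ_x(c)|² · X^{n − wt(x)} · Y^{wt(x)}, where χ_x(c) = ζ_p^{Tr(x·c)}. -/
open scoped Classical

/-- The Hamming weight of a vector. -/
noncomputable def wtv {p k n : ℕ} [Fact p.Prime] (x : Fin n → GaloisField p k) : ℕ :=
  (Finset.univ.filter fun i => x i ≠ 0).card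

/-- The Hamming distance of two vectors. -/
noncomputable def dHv {p k n : ℕ} [Fact p.Prime] (c₁ c₂ : Fin n → GaloisField p k) : ℕ :=
  wtv (c₁ - c₂)

/-- The distance enumerator `D_C(X,Y)` of a code `C ⊆ F_q^n`. -/
noncomputable def distEnum {p k n : ℕ} [Fact p.Prime]
    (C : Finset (Fin n → GaloisField p k)) (X Y : ℂ) : ℂ :=
  (C.card : ℂ)⁻¹ * ∑ c₁ ∈ C, ∑ c₂ ∈ C, X ^ (n - dHv c₁ c₂) * Y ^ (dHv c₁ c₂)

/-- The character `χ_x(c) = ζ_p^{Tr(x·c)}`. -/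
noncomputable def chiv {p k n : ℕ} [Fact p.Prime] (x c : Fin n → GaloisField p k) : ℂ :=
  Complex.exp (2 * Real.pi * Complex.I / p) ^
    ((Algebra.trace (ZMod p) (GaloisField p k) (∑ i, x i * c i)).val)

/-- The product over the coordinates of `X` at zeros and `Y` at nonzeros is the weight monomial. -/
theorem prod_ite_eq_zero_eq_pow_wtv {p k n : ℕ} [Fact p.Prime] (x : Fin n → GaloisField p k)
    (X Y : ℂ) : ∏ i, (if x i = 0 then X else Y) = X ^ (n - wtv x) * Y ^ wtv x := by
  have h := Finset.card_filter_add_card_filter_not (s := (Finset.univ : Finset (Fin n)))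
    (fun i => x i = 0)
  rw [Finset.card_univ, Fintype.card_fin] at h
  rw [Finset.prod_ite, Finset.prod_const, Finset.prod_const, wtv]
  congr 2
  simp only [ne_eq]
  omega

theorem isPrimitiveRoot_exp_prime (p : ℕ) [Fact p.Prime] :
    IsPrimitiveRoot (Complex.exp (2 * Real.pi * Complex.I / p)) p :=
  Complex.isPrimitiveRoot_exp p (NeZero.ne p)

/-- The additive character `a ↦ ζ_p^{Tr a}` of `F_q`. -/
noncomputable def traceChar (p k : ℕ) [Fact p.Prime] : AddChar (GaloisField p k) ℂ :=
  (AddChar.zmodChar p (isPrimitiveRoot_exp_prime p).pow_eq_one).compAddMonoidHom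
    (Algebra.trace (ZMod p) (GaloisField p k)).toAddMonoidHom

theorem AddChar.map_sum_eq_finsetProd {ι A M : Type*} [AddCommMonoid A] [CommMonoid M]
    (ψ : AddChar A M) (s : Finset ι) (f : ι → A) : ψ (∑ i ∈ s, f i) = ∏ i ∈ s, ψ (f i) :=
  map_sum ψ.toAddMonoidHom f s

theorem chiv_eq_traceChar {p k n : ℕ} [Fact p.Prime] (x c : Fin n → GaloisField p k) :
    chiv x c = traceChar p k (∑ i, x i * c i) := rfl

theorem traceChar_isPrimitive (p k : ℕ) [Fact p.Prime] : (traceChar p k).IsPrimitive := by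
  apply AddChar.IsPrimitive.of_ne_one
  obtain ⟨a, ha⟩ := Algebra.trace_surjective (ZMod p) (GaloisField p k) 1
  refine AddChar.ne_one_iff.mpr ⟨a, ?_⟩
  have h : traceChar p k a = AddChar.zmodChar p (isPrimitiveRoot_exp_prime p).pow_eq_one 1 :=
    congrArg (AddChar.zmodChar p (isPrimitiveRoot_exp_prime p).pow_eq_one) ha
  rw [h, AddChar.zmodChar_apply, ZMod.val_one, pow_one]
  exact (isPrimitiveRoot_exp_prime p).ne_one (Fact.out : p.Prime).one_lt

theorem sum_traceChar_mul_ite {p k : ℕ} [Fact p.Prime] [Fintype (GaloisField p k)] (hk : 0 < k)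
    (b : GaloisField p k) (X Y : ℂ) :
    ∑ a, traceChar p k (a * b) * (if a = 0 then X else Y)
      = if b = 0 then X + ((p ^ k - 1 : ℕ) : ℂ) * Y else X - Y := by
  have hcard : Fintype.card (GaloisField p k) = p ^ k := by
    rw [← Nat.card_eq_fintype_card, GaloisField.card p k hk.ne']
  have hsplit : ∀ a : GaloisField p k, traceChar p k (a * b) * (if a = 0 then X else Y)
      = traceChar p k (a * b) * Y + if a = 0 then X - Y else 0 := by
    intro a
    split_ifs with ha <;> simp [ha]
  rw [Finset.sum_congr rfl fun a _ => hsplit a, Finset.sum_add_distrib, ← Finset.sum_mul,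
    AddChar.sum_mulShift b (traceChar_isPrimitive p k), Finset.sum_ite_eq' Finset.univ 0,
    if_pos (Finset.mem_univ _), hcard]
  split_ifs
  · rw [Nat.cast_sub (Nat.one_le_pow _ _ (Fact.out : p.Prime).pos)]
    push_cast
    ring
  · simp

/-- The Fourier transform of the weight monomial. -/
theorem sum_chiv_mul_pow_wtv {p k n : ℕ} [Fact p.Prime] [Fintype (GaloisField p k)] (hk : 0 < k)
    (v : Fin n → GaloisField p k) (X Y : ℂ) :
    ∑ x, chiv x v * (X ^ (n - wtv x) * Y ^ wtv x)
      = (X + ((p ^ k - 1 : ℕ) : ℂ) * Y) ^ (n - wtv v) * (X - Y) ^ wtv v := by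
  simp_rw [← prod_ite_eq_zero_eq_pow_wtv, ← sum_traceChar_mul_ite hk, Fintype.prod_sum,
    chiv_eq_traceChar, AddChar.map_sum_eq_finsetProd, Finset.prod_mul_distrib]

theorem normSq_sum_chiv {p k n : ℕ} [Fact p.Prime] (C : Finset (Fin n → GaloisField p k))
    (x : Fin n → GaloisField p k) :
    ((Complex.normSq (∑ c ∈ C, chiv x c) : ℝ) : ℂ)
      = ∑ c₁ ∈ C, ∑ c₂ ∈ C, chiv x (c₁ - c₂) := by
  rw [← Complex.mul_conj, map_sum, Finset.sum_mul_sum]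
  refine Finset.sum_congr rfl fun c₁ _ => Finset.sum_congr rfl fun c₂ _ => ?_
  simp_rw [chiv_eq_traceChar, Pi.sub_apply, mul_sub, Finset.sum_sub_distrib, sub_eq_add_neg,
    AddChar.map_add_eq_mul, AddChar.map_neg_eq_conj]

theorem stmt6 (p k n : ℕ) [Fact p.Prime] (hk : 0 < k) (hn : 1 ≤ n)
    (C : Finset (Fin n → GaloisField p k)) (hC : C.Nonempty) (X Y : ℂ) :
    distEnum C (X + ((p ^ k - 1 : ℕ) : ℂ) * Y) (X - Y)
      = (C.card : ℂ)⁻¹ * ∑ᶠ x : Fin n → GaloisField p k,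
          ((Complex.normSq (∑ c ∈ C, chiv x c) : ℝ) : ℂ) * X ^ (n - wtv x) * Y ^ (wtv x) := by
  have := Fintype.ofFinite (GaloisField p k)
  rw [finsum_eq_sum_of_fintype, distEnum]
  simp_rw [normSq_sum_chiv, dHv, ← sum_chiv_mul_pow_wtv hk, mul_assoc, Finset.sum_mul]
  simp_rw [Finset.sum_comm (s := Finset.univ)]
end

section
/- Let q = p^k with p prime, n ≥ 1, and let C, C' be nonempty subsets of F_q^n that form a formally dual pair under the canonical isomorphism x ↦ χ_x, i.e., |∑_{c ∈ C} χ_x(c)|² = (|C|²/|C'|)·ν_{C'}(x) for every x ∈ F_q^n. Then for all complex numbers X, Y: D_C(X + (q−1)Y, X − Y) = |C| · D_{C'}(X,Y); that is, C and C' have dual distance enumerators. -/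
open scoped Classical

/-- `ν_T(x) = #{(t₁,t₂) ∈ T×T : t₁ − t₂ = x}`. -/
noncomputable def nuv {p k n : ℕ} [Fact p.Prime]
    (T : Finset (Fin n → GaloisField p k)) (x : Fin n → GaloisField p k) : ℕ :=
  Nat.card {q : (Fin n → GaloisField p k) × (Fin n → GaloisField p k) //
    q.1 ∈ T ∧ q.2 ∈ T ∧ q.1 - q.2 = x}

/-- The additive character `a ↦ ζ_p ^ Tr a` of `F_q`. -/
noncomputable def traceAddChar (p k : ℕ) [Fact p.Prime] : AddChar (GaloisField p k) ℂ :=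
  (ZMod.stdAddChar (N := p)).compAddMonoidHom
    (Algebra.trace (ZMod p) (GaloisField p k)).toAddMonoidHom

theorem traceAddChar_apply {p k : ℕ} [Fact p.Prime] (a : GaloisField p k) :
    traceAddChar p k a = ZMod.stdAddChar (Algebra.trace (ZMod p) (GaloisField p k) a) := rfl

theorem traceAddChar_isPrimitive (p k : ℕ) [Fact p.Prime] : (traceAddChar p k).IsPrimitive := by
  apply AddChar.IsPrimitive.of_ne_one
  obtain ⟨a, ha⟩ := Algebra.trace_surjective (ZMod p) (GaloisField p k) 1
  refine AddChar.ne_one_iff.2 ⟨a, fun h => one_ne_zero (α := ZMod p) ?_⟩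
  rw [traceAddChar_apply, ha, ← (ZMod.stdAddChar (N := p)).map_zero_eq_one] at h
  exact ZMod.injective_stdAddChar h

theorem chiv_eq_traceAddChar {p k n : ℕ} [Fact p.Prime] (x c : Fin n → GaloisField p k) :
    chiv x c = traceAddChar p k (∑ i, x i * c i) := by
  rw [chiv, traceAddChar_apply, ZMod.stdAddChar_apply, ZMod.toCircle_apply, ← Complex.exp_nat_mul]
  congr 1
  ring

theorem chiv_sub {p k n : ℕ} [Fact p.Prime] (x c₁ c₂ : Fin n → GaloisField p k) :
    chiv x (c₁ - c₂) = chiv x c₁ * (starRingEnd ℂ) (chiv x c₂) := by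
  simp only [chiv_eq_traceAddChar, ← AddChar.map_neg_eq_conj, ← AddChar.map_add_eq_mul]
  congr 1
  rw [← sub_eq_add_neg, ← Finset.sum_sub_distrib]
  simp only [Pi.sub_apply, mul_sub]

theorem chiv_eq_prod {p k n : ℕ} [Fact p.Prime] (x c : Fin n → GaloisField p k) :
    chiv x c = ∏ i, traceAddChar p k (x i * c i) := by
  rw [chiv_eq_traceAddChar]
  exact map_prod (traceAddChar p k).toMonoidHom
    (fun i => Multiplicative.ofAdd (x i * c i)) Finset.univ

theorem sum_traceAddChar_mul_ite {p k : ℕ} [Fact p.Prime] [Fintype (GaloisField p k)]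
    (hk : k ≠ 0) (b : GaloisField p k) (X Y : ℂ) :
    ∑ a, (if a = 0 then X else Y) * traceAddChar p k (a * b) =
      if b = 0 then X + ((p ^ k - 1 : ℕ) : ℂ) * Y else X - Y := by
  have hcard : Fintype.card (GaloisField p k) = p ^ k := by
    rw [Fintype.card_eq_nat_card, GaloisField.card p k hk]
  have hsplit : ∀ a : GaloisField p k, (if a = 0 then X else Y) * traceAddChar p k (a * b) =
      (if a = 0 then X - Y else 0) + Y * traceAddChar p k (a * b) := by
    intro a
    split_ifs with h <;> simp [h]
  rw [Finset.sum_congr rfl fun a _ => hsplit a, Finset.sum_add_distrib, ← Finset.mul_sum,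
    AddChar.sum_mulShift b (traceAddChar_isPrimitive p k), hcard]
  have hpos : 1 ≤ p ^ k := Nat.one_le_pow _ _ (Fact.out : p.Prime).pos
  split_ifs <;> simp [Nat.cast_sub hpos]
  ring

/-- The Fourier transform of the Hamming weight monomial `X ^ (n - wt) * Y ^ wt`. -/
theorem sum_pow_wtv_mul_chiv {p k n : ℕ} [Fact p.Prime] [Fintype (GaloisField p k)]
    (hk : k ≠ 0) (c : Fin n → GaloisField p k) (X Y : ℂ) :
    ∑ x, X ^ (n - wtv x) * Y ^ wtv x * chiv x c =
      (X + ((p ^ k - 1 : ℕ) : ℂ) * Y) ^ (n - wtv c) * (X - Y) ^ wtv c := by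
  simp only [← prod_ite_eq_zero_eq_pow_wtv, chiv_eq_prod, ← Finset.prod_mul_distrib,
    ← sum_traceAddChar_mul_ite hk]
  rw [Finset.prod_univ_sum, Fintype.piFinset_univ]

theorem sum_chiv_sub_eq_normSq {p k n : ℕ} [Fact p.Prime] (C : Finset (Fin n → GaloisField p k))
    (x : Fin n → GaloisField p k) :
    ∑ c₁ ∈ C, ∑ c₂ ∈ C, chiv x (c₁ - c₂) = (Complex.normSq (∑ c ∈ C, chiv x c) : ℂ) := by
  simp only [chiv_sub, ← Complex.mul_conj, map_sum, Finset.sum_mul_sum]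

theorem nuv_eq_card_filter {p k n : ℕ} [Fact p.Prime] (T : Finset (Fin n → GaloisField p k))
    (x : Fin n → GaloisField p k) :
    nuv T x = ((T ×ˢ T).filter fun t => t.1 - t.2 = x).card := by
  rw [nuv, Nat.subtype_card]
  simp [and_assoc]

theorem sum_mul_nuv {p k n : ℕ} [Fact p.Prime] [Fintype (GaloisField p k)]
    (T : Finset (Fin n → GaloisField p k)) (f : (Fin n → GaloisField p k) → ℂ) :
    ∑ x, f x * nuv T x = ∑ t₁ ∈ T, ∑ t₂ ∈ T, f (t₁ - t₂) := by
  rw [← Finset.sum_product', ← Finset.sum_fiberwise (T ×ˢ T) (fun t => t.1 - t.2)]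
  refine Finset.sum_congr rfl fun x _ => ?_
  rw [Finset.sum_congr rfl fun t ht => congrArg f (Finset.mem_filter.1 ht).2, Finset.sum_const,
    nuv_eq_card_filter, nsmul_eq_mul, mul_comm]

theorem stmt7 (p k n : ℕ) [Fact p.Prime] (hk : 0 < k) (hn : 1 ≤ n)
    (C C' : Finset (Fin n → GaloisField p k)) (hC : C.Nonempty) (hC' : C'.Nonempty)
    (hdual : ∀ x : Fin n → GaloisField p k,
      Complex.normSq (∑ c ∈ C, chiv x c) = (C.card : ℝ) ^ 2 / (C'.card : ℝ) * nuv C' x)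
    (X Y : ℂ) :
    distEnum C (X + ((p ^ k - 1 : ℕ) : ℂ) * Y) (X - Y) = (C.card : ℂ) * distEnum C' X Y := by
  have : Fintype (GaloisField p k) := Fintype.ofFinite _
  have hC0 : (C.card : ℂ) ≠ 0 := Nat.cast_ne_zero.2 hC.card_pos.ne'
  have hdual' : ∀ x : Fin n → GaloisField p k,
      ∑ c₁ ∈ C, ∑ c₂ ∈ C, chiv x (c₁ - c₂) = (C.card : ℂ) ^ 2 / C'.card * nuv C' x := by
    intro x
    rw [sum_chiv_sub_eq_normSq, hdual]
    push_cast
    rfl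
  have key : ∑ c₁ ∈ C, ∑ c₂ ∈ C, (X + ((p ^ k - 1 : ℕ) : ℂ) * Y) ^ (n - wtv (c₁ - c₂)) *
      (X - Y) ^ wtv (c₁ - c₂) =
      (C.card : ℂ) ^ 2 / C'.card *
        ∑ t₁ ∈ C', ∑ t₂ ∈ C', X ^ (n - wtv (t₁ - t₂)) * Y ^ wtv (t₁ - t₂) := by
    rw [← sum_mul_nuv C' fun x => X ^ (n - wtv x) * Y ^ wtv x, Finset.mul_sum]
    simp only [← sum_pow_wtv_mul_chiv hk.ne']
    rw [Finset.sum_congr rfl fun c₁ _ => Finset.sum_comm, Finset.sum_comm]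
    refine Finset.sum_congr rfl fun x _ => ?_
    simp only [← Finset.mul_sum]
    rw [hdual']
    ring
  simp only [distEnum, dHv]
  rw [key]
  field_simp
end

section
/- Let F : F_{2^n} → F_{2^n} be a function such that S_F = {(x, F(x)) : x ∈ F_{2^n}} is formally self dual under the trace pairing ⟨(x,y),(a,b)⟩ = (−1)^{Tr(ax+by)}. Then F is a bijection of F_{2^n}. -/
open scoped Classical

/-- The sign `(−1)^{Tr(t)} ∈ ℤ`, with `Tr` the absolute trace of `F_{2^n}`. -/
noncomputable def sgn {n : ℕ} (t : GaloisField 2 n) : ℤ :=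
  (-1) ^ (Algebra.trace (ZMod 2) (GaloisField 2 n) t).val

/-- The weight enumerator `ν_S(a,b) = #{(u,v) ∈ S×S : u − v = (a,b)}`. -/
noncomputable def nu2 {n : ℕ} (S : Set (GaloisField 2 n × GaloisField 2 n))
    (g : GaloisField 2 n × GaloisField 2 n) : ℕ :=
  Nat.card {q : (GaloisField 2 n × GaloisField 2 n) × (GaloisField 2 n × GaloisField 2 n) //
    q.1 ∈ S ∧ q.2 ∈ S ∧ q.1 - q.2 = g}

/-- `S ⊆ F_{2^n} × F_{2^n}` is formally self dual under the trace pairing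
`⟨(x,y),(a,b)⟩ = (−1)^{Tr(ax+by)}`. -/
noncomputable def FSDTrace {n : ℕ} (S : Set (GaloisField 2 n × GaloisField 2 n)) : Prop :=
  ∀ a b : GaloisField 2 n,
    (∑ᶠ s ∈ S, sgn (a * s.1 + b * s.2)) ^ 2 = (Nat.card S : ℤ) * nu2 S (a, b)

/-- The graph `S_F = {(x, F(x)) : x ∈ F_{2^n}}`. -/
def graphSet {n : ℕ} (F : GaloisField 2 n → GaloisField 2 n) :
    Set (GaloisField 2 n × GaloisField 2 n) :=
  {q | ∃ x : GaloisField 2 n, q = (x, F x)}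

/-- `δ_F(a,b) = #{x : F(x+a) + F(x) = b}`. -/
noncomputable def deltaF {n : ℕ} (F : GaloisField 2 n → GaloisField 2 n)
    (a b : GaloisField 2 n) : ℕ :=
  Nat.card {x : GaloisField 2 n // F (x + a) + F x = b}

/-- The Walsh transform `W_F(a,b) = ∑_x (−1)^{Tr(bF(x)+ax)}`. -/
noncomputable def walsh {n : ℕ} (F : GaloisField 2 n → GaloisField 2 n)
    (a b : GaloisField 2 n) : ℤ :=
  ∑ᶠ x : GaloisField 2 n, sgn (b * F x + a * x)

theorem sgn_zero {n : ℕ} : sgn (0 : GaloisField 2 n) = 1 := by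
  simp [sgn]

theorem sgn_add {n : ℕ} (s t : GaloisField 2 n) : sgn (s + t) = sgn s * sgn t := by
  have sign_add : ∀ u v : ZMod 2, (-1 : ℤ) ^ (u + v).val = (-1) ^ u.val * (-1) ^ v.val := by
    decide
  simp only [sgn, map_add, sign_add]

theorem exists_sgn_mul_eq_neg_one {n : ℕ} {t : GaloisField 2 n} (ht : t ≠ 0) :
    ∃ b : GaloisField 2 n, sgn (b * t) = -1 := by
  obtain ⟨c, hc⟩ := Algebra.trace_surjective (ZMod 2) (GaloisField 2 n) 1
  refine ⟨c / t, ?_⟩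
  rw [div_mul_cancel₀ c ht, sgn, hc]
  decide

theorem sum_sgn_mul {n : ℕ} [Fintype (GaloisField 2 n)] {t : GaloisField 2 n} (ht : t ≠ 0) :
    ∑ b : GaloisField 2 n, sgn (b * t) = 0 := by
  obtain ⟨c, hc⟩ := exists_sgn_mul_eq_neg_one ht
  have key := Equiv.sum_comp (Equiv.addRight c) fun b => sgn (b * t)
  simp only [Equiv.coe_addRight, add_mul, sgn_add, hc, mul_neg, mul_one,
    Finset.sum_neg_distrib] at key
  linarith

theorem nu2_graphSet_zero {n : ℕ} (F : GaloisField 2 n → GaloisField 2 n)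
    {b : GaloisField 2 n} (hb : b ≠ 0) : nu2 (graphSet F) (0, b) = 0 := by
  refine Nat.card_eq_zero.2 (Or.inl ⟨?_⟩)
  rintro ⟨⟨_, _⟩, ⟨x, rfl⟩, ⟨y, rfl⟩, hxy⟩
  simp only [Prod.mk_sub_mk, Prod.mk.injEq, sub_eq_zero] at hxy
  obtain ⟨rfl, h⟩ := hxy
  exact hb (by simpa using h.symm)

theorem finsum_mem_graphSet {n : ℕ} (F : GaloisField 2 n → GaloisField 2 n)
    (f : GaloisField 2 n × GaloisField 2 n → ℤ) :
    ∑ᶠ s ∈ graphSet F, f s = ∑ᶠ x, f (x, F x) := by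
  have hr : graphSet F = Set.range fun x => (x, F x) := by
    ext q
    simp [graphSet, eq_comm]
  rw [hr, finsum_mem_range fun x y hxy => congrArg Prod.fst hxy]

/-- If all nontrivial component sums of `F` vanish, then `F` is surjective. -/
theorem surjective_of_sum_sgn_eq_zero {n : ℕ} [Fintype (GaloisField 2 n)]
    (F : GaloisField 2 n → GaloisField 2 n)
    (hF : ∀ b : GaloisField 2 n, b ≠ 0 → ∑ x, sgn (b * F x) = 0) :
    Function.Surjective F := by
  intro c
  by_contra! hc
  have h_swap := Finset.sum_comm (s := Finset.univ) (t := Finset.univ)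
    (f := fun b x : GaloisField 2 n => sgn (b * (F x - c)))
  rw [Finset.sum_eq_single 0] at h_swap
  · simp [sgn_zero, sum_sgn_mul (sub_ne_zero.2 (hc _))] at h_swap
  · intro b _ hb
    simp only [sub_eq_add_neg, mul_add, sgn_add, ← Finset.sum_mul, hF b hb, zero_mul]
  · simp

theorem stmt9 (n : ℕ) (hn : 0 < n) (F : GaloisField 2 n → GaloisField 2 n)
    (h : FSDTrace (graphSet F)) : Function.Bijective F := by
  let _ : Fintype (GaloisField 2 n) := Fintype.ofFinite _
  refine Finite.surjective_iff_bijective.1 (surjective_of_sum_sgn_eq_zero F fun b hb => ?_)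
  have hW := h 0 b
  rw [nu2_graphSet_zero F hb, finsum_mem_graphSet, finsum_eq_sum_of_fintype] at hW
  simpa using hW
end

section
/- Let F : F_{2^n} → F_{2^n} be a function such that S_F = {(x, F(x)) : x ∈ F_{2^n}} is formally self dual under the trace pairing ⟨(x,y),(a,b)⟩ = (−1)^{Tr(ax+by)}. Then for all a, b ∈ F_{2^n}, the Walsh value W_F(a,b) is divisible by 2^{⌈(n+1)/2⌉}. -/
open scoped Classical

/-- If `2 ^ (n + 1)` divides a square, then `2 ^ ⌈(n + 1) / 2⌉` divides its root. -/
theorem two_pow_dvd_of_dvd_sq {n : ℕ} {w : ℤ} (h : (2 : ℤ) ^ (n + 1) ∣ w ^ 2) :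
    (2 : ℤ) ^ ((n + 2) / 2) ∣ w := by
  rcases Nat.even_or_odd' n with ⟨k, rfl | rfl⟩
  · have hk : (2 : ℤ) ^ k ∣ w := by
      rw [← Int.pow_dvd_pow_iff (n := 2) two_ne_zero, ← pow_mul, mul_comm k 2]
      exact (pow_dvd_pow 2 (Nat.le_succ _)).trans h
    obtain ⟨c, rfl⟩ := hk
    rw [mul_pow, ← pow_mul, mul_comm k 2, pow_succ] at h
    have hc : (2 : ℤ) ∣ c :=
      Int.prime_two.dvd_of_dvd_pow ((mul_dvd_mul_iff_left (by positivity)).1 h)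
    rw [show (2 * k + 2) / 2 = k + 1 by omega, pow_succ]
    exact mul_dvd_mul_left _ hc
  · rw [show (2 * k + 1 + 2) / 2 = k + 1 by omega,
      ← Int.pow_dvd_pow_iff (n := 2) two_ne_zero, ← pow_mul]
    convert h using 2
    ring

/-- A finite type with a fixed-point-free involution has even cardinality. -/
theorem two_dvd_natCard_of_involutive {α : Type*} [Finite α] {f : α → α}
    (hf : Function.Involutive f) (hne : ∀ x, f x ≠ x) : 2 ∣ Nat.card α := by
  have := Fintype.ofFinite α
  rw [Nat.card_eq_fintype_card, ← ZMod.natCast_eq_zero_iff, Fintype.card,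
    Finset.card_eq_sum_ones, Nat.cast_sum]
  refine Finset.sum_involution (fun x _ => f x) (fun _ _ => by decide) (fun x _ _ => hne x)
    (fun _ _ => Finset.mem_univ _) (fun x _ => hf x)

theorem graphSet_eq_range {n : ℕ} (F : GaloisField 2 n → GaloisField 2 n) :
    graphSet F = Set.range fun x => (x, F x) := by
  ext q
  simp [graphSet, eq_comm]

theorem graph_injective {α β : Type*} (F : α → β) :
    Function.Injective fun x => (x, F x) := fun _ _ h => congrArg Prod.fst h

theorem natCard_graphSet {n : ℕ} (hn : n ≠ 0) (F : GaloisField 2 n → GaloisField 2 n) :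
    Nat.card (graphSet F) = 2 ^ n := by
  rw [graphSet_eq_range, Nat.card_range_of_injective (graph_injective F),
    GaloisField.card 2 n hn]

theorem nu2_zero {n : ℕ} (S : Set (GaloisField 2 n × GaloisField 2 n)) :
    nu2 S 0 = Nat.card S :=
  Nat.card_congr
    { toFun := fun q => ⟨q.1.1, q.2.1⟩
      invFun := fun s => ⟨(s, s), s.2, s.2, sub_self _⟩
      left_inv := fun q => Subtype.ext (Prod.ext rfl (sub_eq_zero.1 q.2.2.2))
      right_inv := fun _ => rfl }

theorem two_dvd_nu2_of_ne_zero {n : ℕ} (S : Set (GaloisField 2 n × GaloisField 2 n))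
    {g : GaloisField 2 n × GaloisField 2 n} (hg : g ≠ 0) : 2 ∣ nu2 S g := by
  refine two_dvd_natCard_of_involutive
    (f := fun q => ⟨q.1.swap, q.2.2.1, q.2.1, ?_⟩) (fun _ => rfl) fun q hq => ?_
  · have hneg : -g = g := Prod.ext (CharTwo.neg_eq _) (CharTwo.neg_eq _)
    rw [Prod.fst_swap, Prod.snd_swap, ← neg_sub, q.2.2.2, hneg]
  · have hswap : q.1.2 = q.1.1 := congrArg (fun r => r.1.1) hq
    exact hg (by rw [← q.2.2.2, hswap, sub_self])

theorem two_dvd_nu2_graphSet {n : ℕ} (hn : n ≠ 0) (F : GaloisField 2 n → GaloisField 2 n)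
    (g : GaloisField 2 n × GaloisField 2 n) : 2 ∣ nu2 (graphSet F) g := by
  rcases eq_or_ne g 0 with rfl | hg
  · rw [nu2_zero, natCard_graphSet hn]
    exact dvd_pow_self 2 hn
  · exact two_dvd_nu2_of_ne_zero _ hg

theorem finsum_mem_graphSet_sgn {n : ℕ} (F : GaloisField 2 n → GaloisField 2 n)
    (a b : GaloisField 2 n) :
    ∑ᶠ s ∈ graphSet F, sgn (a * s.1 + b * s.2) = walsh F a b := by
  rw [graphSet_eq_range, finsum_mem_range (graph_injective F)]
  simp only [walsh, add_comm]

theorem stmt10 (n : ℕ) (hn : 0 < n) (F : GaloisField 2 n → GaloisField 2 n)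
    (h : FSDTrace (graphSet F)) :
    ∀ a b : GaloisField 2 n, (2 : ℤ) ^ ((n + 2) / 2) ∣ walsh F a b := by
  intro a b
  apply two_pow_dvd_of_dvd_sq
  rw [← finsum_mem_graphSet_sgn, h a b, natCard_graphSet hn.ne', pow_succ]
  push_cast
  exact mul_dvd_mul_left _ (mod_cast two_dvd_nu2_graphSet hn.ne' F (a, b))
end

section
/- Let L₁, L₂ : F_{2^n} → F_{2^n} be bijective F₂-linear maps satisfying L₁ = (L₁⁻¹)* and L₂ = (L₂⁻¹)*, where * denotes the adjoint with respect to the trace bilinear form. Let F : F_{2^n} → F_{2^n} be a function and F' = L₂ ∘ F ∘ L₁. If S_F = {(x, F(x)) : x ∈ F_{2^n}} is formally self dual under the trace pairing ⟨(x,y),(a,b)⟩ = (−1)^{Tr(ax+by)}, then so is S_{F'} = {(x, F'(x)) : x ∈ F_{2^n}}. -/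
open scoped Classical

theorem FSDTrace.image {n : ℕ} {S : Set (GaloisField 2 n × GaloisField 2 n)} (hS : FSDTrace S)
    (e : (GaloisField 2 n × GaloisField 2 n) ≃+ (GaloisField 2 n × GaloisField 2 n))
    (he : ∀ g s, sgn ((e g).1 * (e s).1 + (e g).2 * (e s).2) = sgn (g.1 * s.1 + g.2 * s.2)) :
    FSDTrace (e '' S) := by
  intro a b
  obtain ⟨g, hg⟩ := e.surjective (a, b)
  have hnu : nu2 (e '' S) (a, b) = nu2 S g := by
    refine (Nat.card_congr ((e.toEquiv.prodCongr e.toEquiv).subtypeEquiv fun q => ?_)).symm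
    simp [← hg, ← map_sub]
  have hsum : ∑ᶠ s ∈ e '' S, sgn (a * s.1 + b * s.2) = ∑ᶠ s ∈ S, sgn (g.1 * s.1 + g.2 * s.2) := by
    rw [finsum_mem_image e.injective.injOn]
    simp only [← he g, hg]
  rw [hnu, hsum, Nat.card_image_of_injective e.injective]
  exact hS g.1 g.2

theorem stmt18 (n : ℕ) (hn : 0 < n)
    (L₁ L₂ : GaloisField 2 n →ₗ[ZMod 2] GaloisField 2 n)
    (M₁ M₂ : GaloisField 2 n → GaloisField 2 n)
    (hM₁l : ∀ x, M₁ (L₁ x) = x) (hM₁r : ∀ x, L₁ (M₁ x) = x)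
    (hM₂l : ∀ x, M₂ (L₂ x) = x) (hM₂r : ∀ x, L₂ (M₂ x) = x)
    -- `L₁ = (L₁⁻¹)*`: the adjoint of `M₁ = L₁⁻¹` w.r.t. the trace bilinear form is `L₁`.
    (hadj₁ : ∀ x y : GaloisField 2 n, Algebra.trace (ZMod 2) (GaloisField 2 n) (M₁ x * y)
      = Algebra.trace (ZMod 2) (GaloisField 2 n) (x * L₁ y))
    (hadj₂ : ∀ x y : GaloisField 2 n, Algebra.trace (ZMod 2) (GaloisField 2 n) (M₂ x * y)
      = Algebra.trace (ZMod 2) (GaloisField 2 n) (x * L₂ y))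
    (F : GaloisField 2 n → GaloisField 2 n)
    (h : FSDTrace (graphSet F)) :
    FSDTrace (graphSet (fun x => L₂ (F (L₁ x)))) := by
  let e₁ : GaloisField 2 n ≃+ GaloisField 2 n :=
    AddEquiv.symm { L₁ with invFun := M₁, left_inv := hM₁l, right_inv := hM₁r }
  let e₂ : GaloisField 2 n ≃+ GaloisField 2 n :=
    { L₂ with invFun := M₂, left_inv := hM₂l, right_inv := hM₂r }
  have hgraph : graphSet (fun x => L₂ (F (L₁ x))) = e₁.prodCongr e₂ '' graphSet F := by
    ext q
    constructor
    · rintro ⟨x, rfl⟩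
      exact ⟨(L₁ x, F (L₁ x)), ⟨L₁ x, rfl⟩, Prod.ext (hM₁l x) rfl⟩
    · rintro ⟨_, ⟨x, rfl⟩, rfl⟩
      exact ⟨M₁ x, Prod.ext rfl (congrArg (fun y => L₂ (F y)) (hM₁r x).symm)⟩
  rw [hgraph]
  refine h.image _ fun g s => ?_
  change sgn (M₁ g.1 * M₁ s.1 + L₂ g.2 * L₂ s.2) = _
  simp only [sgn, map_add]
  rw [hadj₁, hM₁r, ← hadj₂, hM₂l]
end

section
/- Let L : F_{2^n} → F_{2^n} be the F₂-linear map L(x) = ∑_{i=0}^{n−1} c_i x^{2^i} with c_i ∈ F_{2^n}, and let L*(x) = ∑_{i=0}^{n−1} c_i^{2^{n−i}} x^{2^{n−i}} be its adjoint with respect to the trace bilinear form (exponents taken modulo n). Then L*(L(x)) = x for all x ∈ F_{2^n} (equivalently, L is bijective and L = (L⁻¹)*) if and only if ∑_{i=0}^{n−1} c_i^{2^{n−i}} = 1 and, for every j ∈ {1, …, n−1}, ∑_{i=0}^{n−1} (c_i · c_{i+j})^{2^{n−i}} = 0, where the index i+j is taken modulo n. -/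
open Polynomial in
/-- Over a field with `2 ^ n` elements, a linearized polynomial of `2`-degree less than `n` that
vanishes everywhere has only zero coefficients. -/
theorem linearized_coeff_eq_zero {F : Type*} [Field F] {n : ℕ} (hF : Nat.card F = 2 ^ n)
    (a : Fin n → F) (h : ∀ x : F, ∑ j : Fin n, a j * x ^ (2 ^ (j : ℕ)) = 0) (j : Fin n) :
    a j = 0 := by
  have : Finite F := Nat.finite_of_card_ne_zero (by simp [hF])
  have := Fintype.ofFinite F
  let p : F[X] := ∑ j : Fin n, C (a j) * X ^ (2 ^ (j : ℕ))
  have hcoeff : p.coeff (2 ^ (j : ℕ)) = a j := by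
    simp [p, coeff_C_mul, coeff_X_pow, Fin.val_inj]
  have hdeg : p.degree < (2 ^ n : ℕ) := by
    refine (degree_sum_le _ _).trans_lt ?_
    refine (Finset.sup_lt_iff (WithBot.bot_lt_coe _)).2 fun i _ => ?_
    refine (degree_C_mul_X_pow_le _ _).trans_lt ?_
    exact_mod_cast Nat.pow_lt_pow_right one_lt_two i.isLt
  have hp : p = 0 := by
    refine eq_zero_of_degree_lt_of_eval_finset_eq_zero Finset.univ ?_ fun x _ => ?_
    · rwa [Finset.card_univ, ← Nat.card_eq_fintype_card, hF]
    · simpa [p, eval_finsetSum] using h x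
  rw [← hcoeff, hp, coeff_zero]

/-- The composite of a linearized polynomial map with its trace adjoint, as a linearized
polynomial. -/
theorem linearized_adjoint_comp_self {F : Type*} [Field F] [CharP F 2] {n : ℕ}
    (hF : Nat.card F = 2 ^ n) (c : Fin n → F) (x : F) :
    ∑ i : Fin n, c i ^ 2 ^ (n - (i : ℕ)) *
        (∑ k : Fin n, c k * x ^ 2 ^ (k : ℕ)) ^ 2 ^ (n - (i : ℕ)) =
      ∑ j : Fin n, (∑ i : Fin n, (c i * c (i + j)) ^ 2 ^ (n - (i : ℕ))) * x ^ 2 ^ (j : ℕ) := by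
  have : Finite F := Nat.finite_of_card_ne_zero (by simp [hF])
  have := Fintype.ofFinite F
  have hfrob (y : F) : y ^ 2 ^ n = y := by
    rw [← hF, Nat.card_eq_fintype_card, FiniteField.pow_card]
  simp_rw [Finset.sum_mul]
  rw [Finset.sum_comm]
  refine Finset.sum_congr rfl fun i _ => ?_
  have : NeZero n := ⟨i.pos.ne'⟩
  rw [sum_pow_char_pow, Finset.mul_sum,
    ← Equiv.sum_comp (Equiv.addLeft i) (fun k : Fin n => c i ^ 2 ^ (n - (i : ℕ)) *
      (c k * x ^ 2 ^ (k : ℕ)) ^ 2 ^ (n - (i : ℕ)))]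
  refine Finset.sum_congr rfl fun j _ => ?_
  have hx : (x ^ 2 ^ ((i + j : Fin n) : ℕ)) ^ 2 ^ (n - (i : ℕ)) = x ^ 2 ^ (j : ℕ) := by
    rw [← pow_mul, ← pow_add, Fin.val_add_eq_ite]
    split_ifs with hij
    · congr 2
      omega
    · rw [show (i : ℕ) + j + (n - i) = n + j by omega, pow_add, pow_mul, hfrob]
  rw [Equiv.coe_addLeft, mul_pow, hx, mul_pow, mul_assoc]

theorem stmt19 (n : ℕ) (hn : 0 < n) (c : Fin n → GaloisField 2 n) :
    let L : GaloisField 2 n → GaloisField 2 n :=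
      fun x => ∑ i : Fin n, c i * x ^ (2 ^ (i : ℕ))
    let Lstar : GaloisField 2 n → GaloisField 2 n :=
      fun x => ∑ i : Fin n, (c i) ^ (2 ^ (n - (i : ℕ))) * x ^ (2 ^ (n - (i : ℕ)))
    (∀ x : GaloisField 2 n, Lstar (L x) = x) ↔
      ((∑ i : Fin n, (c i) ^ (2 ^ (n - (i : ℕ)))) = 1 ∧
        ∀ j : Fin n, (j : ℕ) ≠ 0 →
          (∑ i : Fin n, (c i * c (i + j)) ^ (2 ^ (n - (i : ℕ)))) = 0) := by
  intro L Lstar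
  have : NeZero n := ⟨hn.ne'⟩
  have hF : Nat.card (GaloisField 2 n) = 2 ^ n := GaloisField.card 2 n hn.ne'
  let b : Fin n → GaloisField 2 n := fun j =>
    ∑ i : Fin n, (c i * c (i + j)) ^ (2 ^ (n - (i : ℕ)))
  have hcomp (x : GaloisField 2 n) : Lstar (L x) = ∑ j : Fin n, b j * x ^ 2 ^ (j : ℕ) :=
    linearized_adjoint_comp_self hF c x
  have hid (x : GaloisField 2 n) :
      ∑ j : Fin n, (if j = 0 then 1 else 0) * x ^ 2 ^ (j : ℕ) = x := by simp
  have hb_zero : b 0 = (∑ i : Fin n, c i ^ 2 ^ (n - (i : ℕ))) ^ 2 := by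
    rw [sum_pow_char 2]
    exact Finset.sum_congr rfl fun i _ => by rw [add_zero, mul_pow, sq]
  have hb_zero_iff : b 0 = 1 ↔ ∑ i : Fin n, c i ^ 2 ^ (n - (i : ℕ)) = 1 := by
    rw [hb_zero]
    refine ⟨fun h => frobenius_inj _ 2 ?_, fun h => by rw [h, one_pow]⟩
    rw [map_one, frobenius_def, h]
  rw [← hb_zero_iff]
  constructor
  · intro h
    have hb (j : Fin n) : b j = if j = 0 then 1 else 0 := by
      refine sub_eq_zero.1 (linearized_coeff_eq_zero hF
        (fun j => b j - if j = 0 then 1 else 0) (fun x => ?_) j)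
      simp_rw [sub_mul]
      rw [Finset.sum_sub_distrib, ← hcomp, h, hid, sub_self]
    refine ⟨by simp [hb], fun j hj => (hb j).trans (if_neg ?_)⟩
    rintro rfl
    exact hj rfl
  · rintro ⟨h0, h⟩ x
    have hb (j : Fin n) : b j = if j = 0 then 1 else 0 := by
      split_ifs with hj
      · rw [hj, h0]
      · exact h j fun hj' => hj (Fin.ext hj')
    simp_rw [hcomp, hb, hid]
end
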